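/- arXiv:0911.3039 — 4 statements merged into one kernel-verified Lean document; each statement's English description precedes it below -/
import Mathlib

section
/- Let K be a field of characteristic zero and L a finite-dimensional Lie algebra over K whose Killing form is nondegenerate (i.e. L is semisimple). If x ∈ L is a regular element, then the centralizer {y ∈ L : ⁅x, y⁆ = 0} is a Cartan subalgebra of L (a nilpotent, self-normalizing Lie subalgebra). -/
open LieAlgebra LieSubalgebra Module in
/-- Over an infinite field, the Engel subalgebra of a regular element is a Cartan subalgebra. -/
theorem LieAlgebra.IsRegular.isCartanSubalgebra_engel
    {K L : Type*} [Field K] [Infinite K] [LieRing L] [LieAlgebra K L] [Module.Finite K L]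
    {x : L} (hx : LieAlgebra.IsRegular K x) : (engel K x).IsCartanSubalgebra := by
  refine ⟨isNilpotent_of_forall_le_engel (R := K) _ fun y hy ↦ ?_, normalizer_engel _ _⟩
  let Ex : {engel K z | z ∈ engel K x} := ⟨engel K x, x, self_mem_engel _ _, rfl⟩
  suffices h : IsBot Ex from @h ⟨engel K y, y, hy, rfl⟩
  have hK : finrank K L ≤ Cardinal.mk K :=
    Cardinal.natCast_le_aleph0.trans <| Cardinal.infinite_iff.mp ‹Infinite K›
  apply engel_isBot_of_isMin hK (engel K x) Ex le_rfl
  rintro ⟨_, y, hy, rfl⟩ hyx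
  suffices h : finrank K (engel K x) ≤ finrank K (engel K y) from
    (LieSubalgebra.toSubmodule_injective (Submodule.eq_of_le_of_finrank_le hyx h)).ge
  rw [(isRegular_iff_finrank_engel_eq_rank K x).mp hx]
  apply rank_le_finrank_engel

/-- If `L` is a finite-dimensional Lie algebra over a field `K` of characteristic zero
whose Killing form is nondegenerate, and `x` is a regular element, then the centralizer
`{y | ⁅x, y⁆ = 0}` is a Cartan subalgebra of `L`. -/
theorem centralizer_of_isRegular_isCartanSubalgebra
    (K : Type*) [Field K] [CharZero K]
    (L : Type*) [LieRing L] [LieAlgebra K L] [Module.Finite K L]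
    (hB : (killingForm K L).Nondegenerate)
    (x : L) (hx : LieAlgebra.IsRegular K x)
    (H : LieSubalgebra K L) (hH : ∀ y : L, y ∈ H ↔ ⁅x, y⁆ = 0) :
    H.IsCartanSubalgebra := by
  have : LieAlgebra.IsKilling K L := by
    refine ⟨LieSubmodule.toSubmodule_injective ?_⟩
    exact (LieIdeal.coe_killingCompl_top K L).trans hB.ker_eq_bot
  have : Infinite K := CharZero.infinite K
  have hC := hx.isCartanSubalgebra_engel
  suffices h : H = LieSubalgebra.engel K x from h ▸ hC
  ext y
  rw [hH]
  refine ⟨fun h ↦ (LieSubalgebra.mem_engel_iff K x y).mpr ⟨1, by simpa using h⟩, fun hy ↦ ?_⟩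
  exact congrArg Subtype.val (trivial_lie_zero (LieSubalgebra.engel K x) (LieSubalgebra.engel K x)
    ⟨x, LieSubalgebra.self_mem_engel K x⟩ ⟨y, hy⟩)
end

section
/- Let L be a finite-dimensional real Lie algebra and let ℂ ⊗[ℝ] L be its complexification, with the Lie algebra structure obtained by extension of scalars. Then x ∈ L is a regular element of L if and only if 1 ⊗ x is a regular element of the complex Lie algebra ℂ ⊗[ℝ] L. -/
open scoped TensorProduct

namespace LieAlgebra.ExtendScalars

variable (R A L : Type*) [CommRing R] [CommRing A] [Algebra R A] [LieRing L] [LieAlgebra R L]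

attribute [local instance] LieRing.ofAssociativeRing

/-- The adjoint representation of `A ⊗[R] L` is the base change of that of `L`. -/
theorem ad_toLinearMap_eq_baseChange :
    (ad A (A ⊗[R] L)).toLinearMap =
      LinearMap.tensorProduct R A L L ∘ₗ (ad R L).toLinearMap.baseChange A := by
  ext x y
  change ⁅(1 : A) ⊗ₜ[R] x, (1 : A) ⊗ₜ[R] y⁆ =
    ((1 : A) • (ad R L x).baseChange A) ((1 : A) ⊗ₜ[R] y)
  simp

variable [Module.Finite R L] [Module.Free R L]

variable {ι : Type*} [Fintype ι] [DecidableEq ι] (b : Module.Basis ι R L)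

/-- Extension of scalars maps the universal characteristic polynomial of the adjoint representation
to that of the extended Lie algebra. -/
theorem polyCharpoly_ad :
    LinearMap.polyCharpoly (ad A (A ⊗[R] L)).toLinearMap (Algebra.TensorProduct.basis A b) =
      (LinearMap.polyCharpoly (ad R L).toLinearMap b).map
        (MvPolynomial.map (algebraMap R A)) := by
  rw [ad_toLinearMap_eq_baseChange, LinearMap.polyCharpoly_baseChange]

variable {L} in
/-- The characteristic polynomial of `ad x` is compatible with extension of scalars. -/
theorem charpoly_ad_one_tmul (x : L) :
    (ad A (A ⊗[R] L) (1 ⊗ₜ[R] x)).charpoly = (ad R L x).charpoly.map (algebraMap R A) := by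
  rw [← LinearMap.charpoly_baseChange]
  congr 1
  ext y
  simp

variable [Nontrivial R] [Nontrivial A] [FaithfulSMul R A]

/-- The rank of a Lie algebra is invariant under extension of scalars. -/
theorem rank_eq : rank A (A ⊗[R] L) = rank R L := by
  classical
  let b := Module.Free.chooseBasis R L
  have hf : Function.Injective (MvPolynomial.map (σ := Module.Free.ChooseBasisIndex R L)
      (algebraMap R A)) :=
    MvPolynomial.map_injective _ (FaithfulSMul.algebraMap_injective R A)
  rw [rank_eq_natTrailingDegree A (A ⊗[R] L) (Algebra.TensorProduct.basis A b),
    rank_eq_natTrailingDegree R L b, polyCharpoly_ad]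
  simp only [Polynomial.natTrailingDegree, Polynomial.trailingDegree,
    Polynomial.support_map_of_injective _ hf]

variable {L}

/-- Regularity of an element is invariant under extension of scalars. -/
theorem isRegular_one_tmul_iff (x : L) :
    IsRegular A (1 ⊗ₜ[R] x : A ⊗[R] L) ↔ IsRegular R x := by
  rw [isRegular_def, isRegular_def, rank_eq, charpoly_ad_one_tmul, Polynomial.coeff_map,
    map_ne_zero_iff _ (FaithfulSMul.algebraMap_injective R A)]

end LieAlgebra.ExtendScalars

/-- An element `x` of a finite-dimensional real Lie algebra `L` is regular if and only if
`1 ⊗ x` is a regular element of the complexification `ℂ ⊗[ℝ] L`. -/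
theorem isRegular_iff_isRegular_complexification
    (L : Type*) [LieRing L] [LieAlgebra ℝ L] [Module.Finite ℝ L] (x : L) :
    LieAlgebra.IsRegular ℝ x ↔
      LieAlgebra.IsRegular ℂ ((1 : ℂ) ⊗ₜ[ℝ] x : ℂ ⊗[ℝ] L) :=
  (LieAlgebra.ExtendScalars.isRegular_one_tmul_iff ℝ ℂ x).symm
end

section
/- Let K be a field of characteristic zero and L a finite-dimensional Lie algebra over K with nondegenerate Killing form. If x ∈ L is regular, then the Engel subalgebra of x (the generalized 0-eigenspace of ad x) coincides with the centralizer {y ∈ L : ⁅x, y⁆ = 0}; that is, in the semisimple case the generalized null space of a regular element may be computed with s = 1. -/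
namespace LieAlgebra

variable {K L : Type*} [Field K] [LieRing L] [LieAlgebra K L] [Module.Finite K L]

open Module LieSubalgebra Cardinal

/-- The Engel subalgebra of a regular element is a Cartan subalgebra. -/
theorem isCartanSubalgebra_engel_of_isRegular (h : finrank K L ≤ #K) {x : L}
    (hx : IsRegular K x) : (engel K x).IsCartanSubalgebra := by
  refine ⟨?_, normalizer_engel _ _⟩
  apply isNilpotent_of_forall_le_engel
  intro y hy
  set Ex : {engel K z | z ∈ engel K x} := ⟨engel K x, x, self_mem_engel _ _, rfl⟩
  suffices IsBot Ex from @this ⟨engel K y, y, hy, rfl⟩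
  apply engel_isBot_of_isMin h (engel K x) Ex le_rfl
  rintro ⟨_, y, hy, rfl⟩ hyx
  suffices finrank K (engel K x) ≤ finrank K (engel K y) by
    suffices engel K y = engel K x from this.ge
    apply LieSubalgebra.toSubmodule_injective
    exact Submodule.eq_of_le_of_finrank_le hyx this
  rw [(isRegular_iff_finrank_engel_eq_rank K x).mp hx]
  apply rank_le_finrank_engel

end LieAlgebra

/-- If `L` is a finite-dimensional Lie algebra over a field `K` of characteristic zero with
nondegenerate Killing form and `x` is regular, then the Engel subalgebra of `x` (the
generalized `0`-eigenspace of `ad x`) is exactly the centralizer `{y | ⁅x, y⁆ = 0}`. -/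
theorem engel_eq_centralizer_of_isRegular
    (K : Type*) [Field K] [CharZero K]
    (L : Type*) [LieRing L] [LieAlgebra K L] [Module.Finite K L]
    (hB : (killingForm K L).Nondegenerate)
    (x : L) (hx : LieAlgebra.IsRegular K x) :
    ∀ y : L, y ∈ LieSubalgebra.engel K x ↔ ⁅x, y⁆ = 0 := by
  intro y
  refine ⟨fun hy ↦ ?_, fun h ↦ (LieSubalgebra.mem_engel_iff K x y).mpr ⟨1, by simpa using h⟩⟩
  have : LieAlgebra.IsKilling K L :=
    ⟨(LieSubmodule.eq_bot_iff _).mpr fun z hz ↦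
      hB.2 z fun w ↦ (LieIdeal.mem_killingCompl K L ⊤).mp hz w (LieSubmodule.mem_top w)⟩
  have h_card : Module.finrank K L ≤ Cardinal.mk K :=
    Cardinal.natCast_le_aleph0.trans (Cardinal.infinite_iff.mp inferInstance)
  have := LieAlgebra.isCartanSubalgebra_engel_of_isRegular h_card hx
  have hc := trivial_lie_zero (LieSubalgebra.engel K x) (LieSubalgebra.engel K x)
    ⟨x, LieSubalgebra.self_mem_engel K x⟩ ⟨y, hy⟩
  exact congrArg Subtype.val hc
end

section
/- Let K be an algebraically closed field of characteristic zero, L a finite-dimensional Lie algebra over K, and H a Cartan subalgebra of L. Then an element x ∈ H is regular in L if and only if α(x) ≠ 0 for every nonzero weight α of the adjoint action of H on L. In particular, the singular elements of H form the union of the kernels of the roots. -/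
namespace Derivation

variable {R S : Type*} [CommRing R] [CommRing S] [Algebra R S] (D : Derivation R S S) {I : Ideal S}

/-- A derivation that preserves an ideal preserves its powers. -/
theorem apply_mem_pow_of_mem_pow (hD : ∀ f ∈ I, D f ∈ I) {k : ℕ} {f : S} (hf : f ∈ I ^ k) :
    D f ∈ I ^ k := by
  induction k generalizing f with
  | zero => simp
  | succ k ih =>
    rw [pow_succ'] at hf ⊢
    induction hf using Submodule.mul_induction_on' with
    | mem_mul_mem a ha b hb =>
      rw [D.leibniz, smul_eq_mul, smul_eq_mul]
      refine add_mem (Ideal.mul_mem_mul ha (ih hb)) ?_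
      rw [mul_comm b]
      exact Ideal.mul_mem_mul (hD a ha) hb
    | add x _ y _ hx hy => rw [map_add]; exact add_mem hx hy

/-- Euler's identity modulo higher order terms: a derivation that is the identity on `I / I ^ 2`
is multiplication by `k` on `I ^ k / I ^ (k + 1)`. -/
theorem apply_sub_smul_mem_pow_succ (h₀ : ∀ f, D f ∈ I) (h₁ : ∀ f ∈ I, D f - f ∈ I ^ 2)
    {k : ℕ} {f : S} (hf : f ∈ I ^ k) : D f - (k : S) * f ∈ I ^ (k + 1) := by
  induction k generalizing f with
  | zero => simpa using h₀ f
  | succ k ih =>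
    rw [pow_succ'] at hf
    induction hf using Submodule.mul_induction_on' with
    | mem_mul_mem a ha b hb =>
      have h : D (a * b) - ((k + 1 : ℕ) : S) * (a * b) =
          a * (D b - (k : S) * b) + (D a - a) * b := by
        rw [D.leibniz, smul_eq_mul, smul_eq_mul]; push_cast; ring
      rw [h]
      refine add_mem ?_ ?_
      · rw [pow_succ']; exact Ideal.mul_mem_mul ha (ih hb)
      · rw [show k + 1 + 1 = 2 + k by ring, pow_add]; exact Ideal.mul_mem_mul (h₁ a ha) hb
    | add x _ y _ hx hy =>
      rw [map_add, mul_add, add_sub_add_comm]; exact add_mem hx hy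

/-- If the derivative of a matrix is its commutator with `Y`, then the coefficients of its
characteristic polynomial have derivative zero. -/
theorem charpoly_coeff_eq_zero {ι : Type*} [Fintype ι] [DecidableEq ι] (N Y : Matrix ι ι S)
    (h : N.map D = Y * N - N * Y) (k : ℕ) : D (N.charpoly.coeff k) = 0 := by
  let ψ : S →+* DualNumber S :=
    { toFun := fun f => TrivSqZeroExt.inl f + TrivSqZeroExt.inr (D f)
      map_one' := by simp
      map_mul' := fun f g => by
        ext
        · simp
        · simp [mul_comm]
      map_zero' := by simp
      map_add' := fun f g => by
        ext
        · simp
        · simp }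
  let i : S →+* DualNumber S := TrivSqZeroExt.inlHom S S
  let ε : DualNumber S := DualNumber.eps
  have hε : ε * ε = 0 := DualNumber.eps_mul_eps
  let Z : Matrix ι ι (DualNumber S) := ε • Y.map i
  have hZZ (A : Matrix ι ι (DualNumber S)) : Z * A * Z = 0 := by
    simp only [Z, Matrix.smul_mul, Matrix.mul_smul, smul_smul, hε, zero_smul]
  have hZ : Z * Z = 0 := by simpa using hZZ 1
  let u : (Matrix ι ι (DualNumber S))ˣ :=
    { val := 1 + Z
      inv := 1 - Z
      val_inv := by
        rw [add_mul, mul_sub, mul_sub, hZ]; simp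
      inv_val := by
        rw [sub_mul, mul_add, mul_add, hZ]; simp }
  have hψ : N.map ψ = u * N.map i * (↑u⁻¹ : Matrix ι ι (DualNumber S)) := by
    have e1 : u * N.map i * (↑u⁻¹ : Matrix ι ι (DualNumber S)) =
        N.map i + (Z * N.map i - N.map i * Z) := by
      change (1 + Z) * N.map i * (1 - Z) = _
      rw [mul_sub, add_mul, add_mul, add_mul, hZZ]
      simp only [one_mul, mul_one, add_zero]
      abel
    have e2 : Z * N.map i - N.map i * Z = ε • (N.map D).map i := by
      rw [h]
      simp only [Z, Matrix.smul_mul, Matrix.mul_smul, ← smul_sub, ← Matrix.map_mul]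
      congr 1
      rw [Matrix.map_sub _ (map_sub i)]
    rw [e1, e2]
    ext a b
    · simp [ψ, i, ε]
    · simp [ψ, i, ε]
  have hc : (N.map ψ).charpoly = (N.map i).charpoly := by
    rw [hψ, Matrix.coe_units_inv, Matrix.charpoly_units_conj]
  rw [Matrix.charpoly_map, Matrix.charpoly_map] at hc
  have := congrArg (fun q => TrivSqZeroExt.snd (q.coeff k)) hc
  simpa [ψ, i] using this

end Derivation

namespace MvPolynomial

variable {K m n : Type*} [Field K]

/-- The ideal of polynomials vanishing on the coordinate subspace where the second set of
coordinates is zero. -/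
noncomputable def vanishingInr (K m n : Type*) [Field K] : Ideal (MvPolynomial (m ⊕ n) K) :=
  Ideal.span (Set.range fun j : n => X (Sum.inr j))

theorem X_inr_mem_vanishingInr (j : n) : X (Sum.inr j) ∈ vanishingInr K m n :=
  Ideal.subset_span ⟨j, rfl⟩

theorem derivation_mem_vanishingInr
    (D : Derivation K (MvPolynomial (m ⊕ n) K) (MvPolynomial (m ⊕ n) K))
    (hD : ∀ j : n, D (X (Sum.inr j)) ∈ vanishingInr K m n) :
    ∀ f ∈ vanishingInr K m n, D f ∈ vanishingInr K m n := by
  intro f hf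
  refine Submodule.span_induction ?_ (by simp) (fun x y _ _ hx hy => ?_) (fun s x hx h => ?_) hf
  · rintro _ ⟨j, rfl⟩
    exact hD j
  · rw [map_add]; exact add_mem hx hy
  · rw [smul_eq_mul, D.leibniz, smul_eq_mul, smul_eq_mul]
    exact add_mem (Ideal.mul_mem_left _ _ h) (Ideal.mul_mem_right _ _ hx)

theorem mem_vanishingInr_of_eval_eq_zero [Infinite K] {p : MvPolynomial (m ⊕ n) K}
    (hp : ∀ a : m → K, eval (Sum.elim a 0) p = 0) : p ∈ vanishingInr K m n := by
  let φ : MvPolynomial (m ⊕ n) K →ₐ[K] MvPolynomial m K := aeval (Sum.elim X 0)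
  let g : MvPolynomial m K →ₐ[K] MvPolynomial (m ⊕ n) K := rename Sum.inl
  have hφ : φ p = 0 := by
    refine funext fun a => ?_
    have h : (aeval a : MvPolynomial m K →ₐ[K] K).comp φ = aeval (Sum.elim a 0) := by
      ext (i | j) <;> simp [φ]
    have := DFunLike.congr_fun h p
    simp only [AlgHom.comp_apply] at this
    rw [map_zero, ← hp a]
    exact this
  have h : (Ideal.Quotient.mkₐ K (vanishingInr K m n)).comp (g.comp φ) =
      Ideal.Quotient.mkₐ K (vanishingInr K m n) := by
    ext (i | j)
    · simp [φ, g]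
    · simpa [φ, g] using (Ideal.Quotient.eq_zero_iff_mem.2 (X_inr_mem_vanishingInr j)).symm
  have := DFunLike.congr_fun h p
  simp only [AlgHom.comp_apply, hφ, map_zero] at this
  exact Ideal.Quotient.eq_zero_iff_mem.1 this.symm

variable [CharZero K] [Fintype m] [Fintype n] [DecidableEq n]

theorem det_mul_mem_vanishingInr_pow_succ (c : n → m ⊕ n → MvPolynomial (m ⊕ n) K)
    {k : ℕ} (hk : k ≠ 0) {q : MvPolynomial (m ⊕ n) K} (hq : q ∈ vanishingInr K m n ^ k)
    (hD : ∀ y, mkDerivation K (c y) q ∈ vanishingInr K m n ^ k) :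
    (Matrix.of fun y l => c y (Sum.inr l)).det * q ∈ vanishingInr K m n ^ (k + 1) := by
  classical
  set I := vanishingInr K m n
  set M : Matrix n n (MvPolynomial (m ⊕ n) K) := Matrix.of fun y l => c y (Sum.inr l)
  have hcoe (F : m ⊕ n → Derivation K (MvPolynomial (m ⊕ n) K) (MvPolynomial (m ⊕ n) K)) (f) :
      (∑ i, F i) f = ∑ i, F i f := by
    simpa using congrFun (map_sum Derivation.coeFnAddMonoidHom F Finset.univ) f
  have hsum (d : m ⊕ n → MvPolynomial (m ⊕ n) K) :
      mkDerivation K d q = ∑ i, d i * pderiv i q := by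
    have : mkDerivation K d = ∑ i, d i • pderiv i := by
      refine derivation_ext fun j => ?_
      rw [hcoe]
      simp [mkDerivation_X, pderiv_X, Pi.single_apply]
    rw [this, hcoe]
    simp
  have hinl (i : m) : pderiv (Sum.inl i) q ∈ I ^ k :=
    Derivation.apply_mem_pow_of_mem_pow _
      (derivation_mem_vanishingInr _ fun j => by simp [pderiv_X]) hq
  have hM (y : n) : (M.mulVec fun l => pderiv (Sum.inr l) q) y ∈ I ^ k := by
    have h := hD y
    rw [hsum, Fintype.sum_sum_type] at h
    exact (Ideal.add_mem_iff_right _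
      (Ideal.sum_mem _ fun i _ => Ideal.mul_mem_left _ _ (hinl i))).1 h
  have hdet (l : n) : M.det * pderiv (Sum.inr l) q ∈ I ^ k := by
    have h : M.adjugate.mulVec (M.mulVec fun l => pderiv (Sum.inr l) q) l =
        M.det * pderiv (Sum.inr l) q := by
      rw [Matrix.mulVec_mulVec, Matrix.adjugate_mul, Matrix.smul_mulVec, Matrix.one_mulVec]
      simp
    rw [← h]
    exact Ideal.sum_mem _ fun y _ => Ideal.mul_mem_left _ _ (hM y)
  let E : Derivation K (MvPolynomial (m ⊕ n) K) (MvPolynomial (m ⊕ n) K) :=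
    mkDerivation K (Sum.elim 0 fun l : n => (X (Sum.inr l) : MvPolynomial (m ⊕ n) K))
  have hE0 (f) : E f ∈ I := by
    induction f using MvPolynomial.induction_on with
    | C a => simp [E]
    | add p q hp hq => rw [map_add]; exact add_mem hp hq
    | mul_X p i hp =>
      rw [E.leibniz, smul_eq_mul, smul_eq_mul]
      refine add_mem (Ideal.mul_mem_left _ _ ?_) (Ideal.mul_mem_left _ _ hp)
      obtain i | j := i
      · simp [E, mkDerivation_X]
      · simpa [E, mkDerivation_X] using X_inr_mem_vanishingInr j
  have hE1 (f) (hf : f ∈ I) : E f - f ∈ I ^ 2 := by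
    refine Submodule.span_induction ?_ (by simp) (fun x y _ _ hx hy => ?_)
      (fun s x hx h => ?_) hf
    · rintro _ ⟨j, rfl⟩
      simp [E, mkDerivation_X]
    · rw [map_add, add_sub_add_comm]; exact add_mem hx hy
    · rw [smul_eq_mul, E.leibniz, smul_eq_mul, smul_eq_mul,
        show s * E x + x * E s - s * x = s * (E x - x) + x * E s by ring]
      refine add_mem (Ideal.mul_mem_left _ _ h) ?_
      rw [pow_two]
      exact Ideal.mul_mem_mul hx (hE0 s)
  have hEq : M.det * E q ∈ I ^ (k + 1) := by
    rw [hsum, Fintype.sum_sum_type, Finset.sum_eq_zero (by simp), zero_add, Finset.mul_sum]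
    refine Ideal.sum_mem _ fun l _ => ?_
    rw [mul_left_comm, pow_succ']
    exact Ideal.mul_mem_mul (X_inr_mem_vanishingInr l) (hdet l)
  have hkq : (k : MvPolynomial (m ⊕ n) K) * (M.det * q) ∈ I ^ (k + 1) := by
    have h := Ideal.mul_mem_left _ M.det
      (E.apply_sub_smul_mem_pow_succ hE0 hE1 hq)
    rw [mul_sub, ← neg_mem_iff, neg_sub] at h
    have := add_mem h hEq
    rw [sub_add_cancel] at this
    rwa [mul_left_comm] at this
  have hk' : C ((k : K)⁻¹) * ((k : MvPolynomial (m ⊕ n) K) * (M.det * q)) = M.det * q := by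
    rw [← mul_assoc, ← map_natCast (C : K →+* MvPolynomial (m ⊕ n) K), ← C_mul,
      inv_mul_cancel₀ (Nat.cast_ne_zero.2 hk), C_1, one_mul]
  rw [← hk']
  exact Ideal.mul_mem_left _ _ hkq

/-- A polynomial that vanishes on a coordinate subspace, and is annihilated by a family of vector
fields which is transverse to that subspace at one of its points, is zero. -/
theorem eq_zero_of_transverse (c : n → m ⊕ n → MvPolynomial (m ⊕ n) K)
    {p : MvPolynomial (m ⊕ n) K} (hD : ∀ y, mkDerivation K (c y) p = 0) (a : m → K)
    (hdet : (Matrix.of fun y l => eval (Sum.elim a 0) (c y (Sum.inr l))).det ≠ 0)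
    (hp : ∀ a : m → K, eval (Sum.elim a 0) p = 0) : p = 0 := by
  set I := vanishingInr K m n
  set δ := (Matrix.of fun y l => c y (Sum.inr l)).det
  have hpow (k : ℕ) : ∃ N : ℕ, δ ^ N * p ∈ I ^ (k + 1) := by
    induction k with
    | zero => exact ⟨0, by simpa using mem_vanishingInr_of_eval_eq_zero hp⟩
    | succ k ih =>
      obtain ⟨N, hN⟩ := ih
      refine ⟨N + 2, ?_⟩
      have hq : δ ^ (N + 1) * p ∈ I ^ (k + 1) := by
        rw [pow_succ' δ, mul_assoc]; exact Ideal.mul_mem_left _ _ hN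
      have := det_mul_mem_vanishingInr_pow_succ c k.succ_ne_zero hq fun y => by
        rw [Derivation.leibniz, hD, smul_zero, zero_add, Derivation.leibniz_pow]
        rw [Nat.add_sub_cancel, smul_eq_mul, nsmul_eq_mul, smul_eq_mul]
        convert Ideal.mul_mem_left _ ((N + 1 : ℕ) * mkDerivation K (c y) δ) hN using 1
        ring
      rwa [← mul_assoc, ← pow_succ'] at this
  let J : Ideal (MvPolynomial (m ⊕ n) K) := RingHom.ker (eval (Sum.elim a 0))
  have hJ : J.IsMaximal := RingHom.ker_isMaximal_of_surjective _ fun r => ⟨C r, by simp⟩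
  have hIJ : I ≤ J := by
    refine Ideal.span_le.2 ?_
    rintro _ ⟨j, rfl⟩
    simp [J, RingHom.mem_ker]
  have hδ : δ ∉ J := by
    rw [RingHom.mem_ker, RingHom.map_det]
    exact hdet
  have hmem (k : ℕ) : p ∈ J ^ k := by
    obtain ⟨N, hN⟩ := hpow k
    have hN' : δ ^ N * p ∈ J ^ k := Ideal.pow_le_pow_right k.le_succ (Ideal.pow_right_mono hIJ _ hN)
    have hcop : IsCoprime (Ideal.span {δ ^ N}) (J ^ k) := by
      rw [← Ideal.span_singleton_pow]
      refine IsCoprime.pow ?_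
      obtain ⟨r, s, hs, h⟩ := hJ.exists_inv hδ
      exact Ideal.isCoprime_iff_exists.2
        ⟨r * δ, Ideal.mem_span_singleton'.2 ⟨r, rfl⟩, s, hs, h⟩
    obtain ⟨s, hs, t, ht, hst⟩ := Ideal.isCoprime_iff_exists.1 hcop
    obtain ⟨r, rfl⟩ := Ideal.mem_span_singleton'.1 hs
    rw [← one_mul p, ← hst, add_mul, mul_assoc]
    exact add_mem (Ideal.mul_mem_left _ _ hN') (Ideal.mul_mem_right _ _ ht)
  have : p ∈ ⨅ k : ℕ, J ^ k := Ideal.mem_iInf.2 hmem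
  rwa [Ideal.iInf_pow_eq_bot_of_isDomain J hJ.ne_top, Ideal.mem_bot] at this

end MvPolynomial

namespace LieAlgebra

open Module MvPolynomial

variable {K L ι : Type*} [Field K] [LieRing L] [LieAlgebra K L] [Fintype ι]
  (b : Module.Basis ι K L)

/-- The coordinates of the polynomial vector field `x ↦ ⁅y, x⁆`. -/
noncomputable def adVectorField (y : L) (i : ι) : MvPolynomial ι K :=
  ∑ j, X j * C (b.repr ⁅y, b j⁆ i)

theorem eval_adVectorField (x y : L) (i : ι) :
    eval (b.repr x) (adVectorField b y i) = b.repr ⁅y, x⁆ i := by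
  conv_rhs => rw [← b.sum_repr x, lie_sum, map_sum]
  simp [adVectorField, Finsupp.finsetSum_apply]

variable [DecidableEq ι]

/-- The matrix of the adjoint action of the generic element `∑ i, X i • b i`. -/
noncomputable def genericAd : Matrix ι ι (MvPolynomial ι K) :=
  ∑ i, (X i : MvPolynomial ι K) • (LinearMap.toMatrix b b (ad K L (b i))).map C

theorem map_eval_genericAd (x : L) :
    (genericAd b).map (eval (b.repr x)) = LinearMap.toMatrix b b (ad K L x) := by
  conv_rhs => rw [← b.sum_repr x, map_sum, map_sum]
  ext k l
  simp [genericAd, Matrix.sum_apply]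

theorem eval_coeff_charpoly_genericAd [Module.Finite K L] (x : L) (r : ℕ) :
    eval (b.repr x) ((genericAd b).charpoly.coeff r) = (ad K L x).charpoly.coeff r := by
  rw [← LinearMap.charpoly_toMatrix _ b, ← map_eval_genericAd, Matrix.charpoly_map,
    Polynomial.coeff_map]

theorem map_mkDerivation_genericAd (y : L) :
    (genericAd b).map (mkDerivation K (adVectorField b y)) =
      (LinearMap.toMatrix b b (ad K L y)).map C * genericAd b -
        genericAd b * (LinearMap.toMatrix b b (ad K L y)).map C := by
  set D := mkDerivation K (adVectorField b y)
  have h1 : (genericAd b).map D =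
      ∑ i, adVectorField b y i • (LinearMap.toMatrix b b (ad K L (b i))).map C := by
    ext k l
    simp [genericAd, Matrix.sum_apply, D, mkDerivation_X, mul_comm]
  have h2 : ∀ j, (∑ i, (C (b.repr ⁅y, b j⁆ i) : MvPolynomial ι K) •
      (LinearMap.toMatrix b b (ad K L (b i))).map (C : K →+* MvPolynomial ι K)) =
      (LinearMap.toMatrix b b (ad K L y)).map C * (LinearMap.toMatrix b b (ad K L (b j))).map C -
      (LinearMap.toMatrix b b (ad K L (b j))).map C *
        (LinearMap.toMatrix b b (ad K L y)).map C := by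
    intro j
    have h3 : LinearMap.toMatrix b b (ad K L ⁅y, b j⁆) =
        LinearMap.toMatrix b b (ad K L y) * LinearMap.toMatrix b b (ad K L (b j)) -
        LinearMap.toMatrix b b (ad K L (b j)) * LinearMap.toMatrix b b (ad K L y) := by
      rw [← LinearMap.toMatrix_mul, ← LinearMap.toMatrix_mul, ← map_sub]
      congr 1
      ext z
      simp
    rw [← Matrix.map_mul, ← Matrix.map_mul, ← Matrix.map_sub _ (map_sub C), ← h3]
    conv_rhs => rw [← b.sum_repr ⁅y, b j⁆, map_sum, map_sum]
    ext k l
    simp [Matrix.sum_apply]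
  rw [h1, genericAd, Finset.mul_sum, Finset.sum_mul, ← Finset.sum_sub_distrib]
  simp only [adVectorField, Finset.sum_smul, mul_smul]
  rw [Finset.sum_comm]
  refine Finset.sum_congr rfl fun j _ => ?_
  rw [← Finset.smul_sum, h2, smul_sub, Matrix.mul_smul, Matrix.smul_mul]

theorem mkDerivation_coeff_charpoly_genericAd (y : L) (r : ℕ) :
    mkDerivation K (adVectorField b y) ((genericAd b).charpoly.coeff r) = 0 :=
  Derivation.charpoly_coeff_eq_zero _ _ _ (map_mkDerivation_genericAd b y) r

end LieAlgebra

namespace LieSubalgebra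

open Module LieAlgebra MvPolynomial

variable {K L : Type*} [Field K] [LieRing L] [LieAlgebra K L] (H : LieSubalgebra K L)

theorem le_engel_of_mem [H.IsCartanSubalgebra] {x : L} (hx : x ∈ H) : H ≤ engel K x := by
  intro z hz
  obtain ⟨k, hk⟩ := (mem_zeroRootSubalgebra K L H z).1 (le_zeroRootSubalgebra K L H hz) ⟨x, hx⟩
  exact (mem_engel_iff K x z).2 ⟨k, hk⟩

variable [Module.Finite K L]

theorem exists_engel_eq [Infinite K] [H.IsCartanSubalgebra] : ∃ x ∈ H, engel K x = H := by
  obtain ⟨x, hx⟩ : ∃ x : H, ∀ y : H, finrank K (engel K (x : L)) ≤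
      finrank K (engel K (y : L)) := by
    let f (y : H) : ℕ := finrank K (engel K (y : L))
    exact ⟨Function.argmin f, fun y => Function.argmin_le f y⟩
  have hbot := engel_isBot_of_isMin (Cardinal.natCast_le_aleph0.trans
    (Cardinal.infinite_iff.1 ‹Infinite K›)) H ⟨engel K (x : L), x, x.2, rfl⟩
    (H.le_engel_of_mem x.2) (by
      rintro ⟨_, y, hy, rfl⟩ hyx
      exact (toSubmodule_injective
        (Submodule.eq_of_le_of_finrank_le (show (engel K y).toSubmodule ≤ _ from hyx)
          (hx ⟨y, hy⟩))).ge)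
  refine ⟨x, x.2, le_antisymm (fun z hz => ?_) (H.le_engel_of_mem x.2)⟩
  rw [← zeroRootSubalgebra_eq_of_is_cartan K L H, mem_zeroRootSubalgebra]
  exact fun y => (mem_engel_iff K (y : L) z).1 (hbot ⟨_, y, y.2, rfl⟩ hz)

theorem exists_isRegular [CharZero K] [H.IsCartanSubalgebra] :
    ∃ x ∈ H, LieAlgebra.IsRegular K x := by
  obtain ⟨h, hH, hh⟩ := H.exists_engel_eq
  by_contra! hreg
  let b₁ := finBasis K H.toSubmodule
  let b₂ := finBasis K (L ⧸ H.toSubmodule)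
  let b := b₁.sumQuot b₂
  have hrepr (x : L) (j) : b.repr x (Sum.inr j) = b₂.repr (Submodule.Quotient.mk x) j := by
    conv_rhs => rw [← b.sum_repr x]
    rw [Fintype.sum_sum_type]
    have h1 (i) : H.toSubmodule.mkQ (b (Sum.inl i)) = 0 := by
      simp [b, Submodule.Quotient.mk_eq_zero]
    have h2 (i) : H.toSubmodule.mkQ (b (Sum.inr i)) = b₂ i := by
      simp [b]
    rw [← Submodule.mkQ_apply]
    simp only [map_add, map_sum, map_smul, h1, h2]
    simp [Finsupp.finsetSum_apply, Finsupp.single_apply]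
  have hmem (x : L) : x ∈ H ↔ ∀ j, b.repr x (Sum.inr j) = 0 := by
    simp_rw [hrepr]
    rw [← mem_toSubmodule, ← Submodule.Quotient.mk_eq_zero, ← b₂.repr.map_eq_zero_iff,
      DFunLike.ext_iff]
    rfl
  have helim (x : L) (hx : x ∈ H) :
      (b.repr x : _ → K) = Sum.elim (fun i => b.repr x (Sum.inl i)) 0 := by
    ext (i | j)
    · rfl
    · simpa using (hmem x).1 hx j
  have hzero : (genericAd b).charpoly.coeff (rank K L) = 0 := by
    refine eq_zero_of_transverse (fun y => adVectorField b (b (Sum.inr y)))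
      (fun y => mkDerivation_coeff_charpoly_genericAd b _ _)
      (fun i => b.repr h (Sum.inl i)) ?_ fun a => ?_
    · simp_rw [← helim h hH, eval_adVectorField]
      intro hdet
      obtain ⟨v, hv, hv0⟩ := Matrix.exists_vecMul_eq_zero_iff.2 hdet
      let w : L := ∑ j, v j • b (Sum.inr j)
      have hwv (j) : b.repr w (Sum.inr j) = v j := by
        simp [w, Finsupp.finsetSum_apply, Finsupp.single_apply]
      have hwh : ⁅w, h⁆ ∈ H := by
        rw [hmem]
        intro j
        simpa [w, Matrix.vecMul, dotProduct, sum_lie, Finsupp.finsetSum_apply] using congrFun hv0 j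
      have hw : w ∈ H := by
        rw [← hh] at hwh ⊢
        rw [← lie_skew, neg_mem_iff, mem_engel_iff] at hwh
        obtain ⟨k, hk⟩ := hwh
        exact (mem_engel_iff K h w).2 ⟨k + 1, by rw [pow_succ]; exact hk⟩
      exact hv (funext fun j => (hwv j).symm.trans ((hmem w).1 hw j))
    · let x : L := ∑ i, a i • b (Sum.inl i)
      have hx : (b.repr x : _ → K) = Sum.elim a 0 := by
        ext (i | j) <;> simp [x, Finsupp.finsetSum_apply, Finsupp.single_apply]
      have hxH : x ∈ H := (hmem x).2 fun j => by rw [hx]; rfl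
      rw [← hx, eval_coeff_charpoly_genericAd]
      simpa [LieAlgebra.isRegular_def] using hreg x hxH
  obtain ⟨x, hx⟩ := LieAlgebra.exists_isRegular K L
  rw [LieAlgebra.isRegular_def, ← eval_coeff_charpoly_genericAd b, hzero, map_zero] at hx
  exact hx rfl

theorem finrank_eq_rank [CharZero K] [H.IsCartanSubalgebra] :
    finrank K H = LieAlgebra.rank K L := by
  obtain ⟨h, -, hh⟩ := H.exists_engel_eq
  obtain ⟨z, hz, hreg⟩ := H.exists_isRegular
  refine le_antisymm ?_ (hh ▸ rank_le_finrank_engel K h)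
  rw [← (isRegular_iff_finrank_engel_eq_rank K z).1 hreg]
  exact Submodule.finrank_mono (H.le_engel_of_mem hz)

theorem isRegular_iff_engel_eq [CharZero K] [H.IsCartanSubalgebra] {x : L} (hx : x ∈ H) :
    LieAlgebra.IsRegular K x ↔ engel K x = H := by
  rw [isRegular_iff_finrank_engel_eq_rank, ← H.finrank_eq_rank]
  refine ⟨fun h => ?_, fun h => by rw [h]⟩
  exact (toSubmodule_injective
    (Submodule.eq_of_le_of_finrank_eq (H.le_engel_of_mem hx) h.symm)).symm

end LieSubalgebra

open LieModule LieAlgebra in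
/-- Over an algebraically closed field of characteristic zero, an element `x` of a Cartan
subalgebra `H` of a finite-dimensional Lie algebra `L` is regular if and only if `α x ≠ 0`
for every nonzero weight `α` of the adjoint action of `H` on `L`. -/
theorem isRegular_iff_forall_weight_ne_zero
    (K : Type*) [Field K] [IsAlgClosed K] [CharZero K]
    (L : Type*) [LieRing L] [LieAlgebra K L] [Module.Finite K L]
    (H : LieSubalgebra K L) [H.IsCartanSubalgebra] (x : H) :
    LieAlgebra.IsRegular K (x : L) ↔
      ∀ α : LieModule.Weight K H L, α.IsNonZero → α x ≠ 0 := by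
  rw [H.isRegular_iff_engel_eq x.2]
  have hmem (z : L) : z ∈ genWeightSpaceOf L (0 : K) x ↔ z ∈ LieSubalgebra.engel K (x : L) := by
    rw [mem_genWeightSpaceOf, LieSubalgebra.mem_engel_iff]
    simp only [zero_smul, sub_zero]
    rfl
  constructor
  · intro hx α hα h0
    have hle : genWeightSpace L α ≤ rootSpace H 0 := by
      intro z hz
      have := genWeightSpace_le_genWeightSpaceOf L x α hz
      rw [h0, hmem, hx] at this
      rwa [rootSpace_zero_eq, LieSubalgebra.mem_toLieSubmodule]
    exact α.genWeightSpace_ne_bot'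
      (le_bot_iff.1 (disjoint_genWeightSpace K H L hα le_rfl hle))
  · intro h
    refine le_antisymm (fun z hz => ?_) (H.le_engel_of_mem x.2)
    rw [← LieSubalgebra.mem_toLieSubmodule, ← rootSpace_zero_eq K L H]
    rw [← hmem, eq_iSup_inf_genWeightSpace K H L (genWeightSpaceOf L (0 : K) x)] at hz
    refine (iSup_le fun α => ?_ : _ ≤ rootSpace H 0) hz
    by_cases hα : α.IsZero
    · rw [hα.eq]; exact inf_le_right
    · have hd : Disjoint (genWeightSpaceOf L (0 : K) x) (genWeightSpaceOf L (α x) x) :=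
        disjoint_genWeightSpaceOf K H L (h α hα).symm
      rw [(hd.mono_right (genWeightSpace_le_genWeightSpaceOf L x α)).eq_bot]
      exact bot_le
end
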